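/- Suppose β = 0, p > 1/2 and M ∈ (0,∞). Then there exist a constant C ∈ (0,∞) and a finite subset F ⊂ 𝒟 such that for every configuration S ∈ 𝒟∖F, the one-step expected increment of f₂^M for the discrete-time exclusion-voter chain satisfies E_{0,p}[ (f₂(ξ_{t+1}))^M − (f₂(ξ_t))^M | ξ_t = S ] ≤ −C (f₂(S))^{M−5/6}, i.e. Σ_{S'∈𝒟} P(S,S') (f₂(S'))^M − (f₂(S))^M ≤ −C (f₂(S))^{M−5/6}, where P denotes the one-step transition kernel of the chain. -/

import Mathlib

open MeasureTheory Filter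
open scoped ENNReal NNReal

namespace EV

/-- A configuration of the exclusion-voter model is the finite hybrid-zone word
(`false` = 0, `true` = 1); the full two-sided configuration is `1^∞ w 0^∞`. -/
abbrev Word := List Bool

/-- Canonical (normalized) words: empty (the ground state `𝒟₀`) or starting with
a `0` and ending with a `1`; these are in bijection with the configuration space `𝒟`. -/
def IsConfig (w : Word) : Prop :=
  w = [] ∨ (w.head? = some false ∧ w.getLast? = some true)

/-- The ground-state Heaviside configuration `𝒟₀ = …111000…`. -/
def groundState : Word := []

/-- Pad a word with one boundary symbol of the adjacent infinite block on each side. -/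
def pad (w : Word) : Word := true :: (w ++ [false])

/-- Normalize: strip leading `1`s (they merge into the left infinite block of `1`s)
and trailing `0`s (they merge into the right infinite block of `0`s). -/
def strip (w : Word) : Word :=
  ((w.dropWhile (· = true)).reverse.dropWhile (· = false)).reverse

def setPair (w : Word) (i : ℕ) (a b : Bool) : Word := (w.set i a).set (i + 1) b

def swapPair (w : Word) (i : ℕ) : Word :=
  setPair w i (w.getD (i + 1) true) (w.getD i true)

/-- Indices of the unlike adjacent pairs (`01` or `10`), read off the padded word. -/
def unlike (w : Word) : List ℕ :=
  (List.range (w.length + 1)).filter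
    (fun i => (pad w).getD i true ≠ (pad w).getD (i + 1) true)

/-- One-step transition kernel of the discrete-time exclusion-voter chain with mixing
parameter `β` and exclusion parameter `p`: an unlike adjacent pair is chosen uniformly
at random; with probability `β` a voter move flips the pair to `00` or `11` (each with
probability `1/2`); with probability `1-β` an exclusion move swaps a `01` with
probability `p` and a `10` with probability `1-p` (otherwise no change). -/
noncomputable def P (β p : ℝ) (w w' : Word) : ℝ :=
  ((unlike w).map (fun i =>
    let a := (pad w).getD i true
    let swapProb := if a then 1 - p else p
    ((unlike w).length : ℝ)⁻¹ *
      (β * (1 / 2) * (if strip (setPair (pad w) i false false) = w' then 1 else 0)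
       + β * (1 / 2) * (if strip (setPair (pad w) i true true) = w' then 1 else 0)
       + (1 - β) * swapProb * (if strip (swapPair (pad w) i) = w' then 1 else 0)
       + (1 - β) * (1 - swapProb) * (if w = w' then 1 else 0)))).sum

/-- `n`-step transition probabilities. -/
noncomputable def Pn (β p : ℝ) : ℕ → Word → Word → ℝ
  | 0 => fun w w' => if w = w' then 1 else 0
  | n + 1 => fun w w' => ∑' z : Word, Pn β p n w z * P β p z w'

/-- `w'` is accessible from `w`: some `n`-step transition probability is positive. -/
def Accessible (β p : ℝ) (w w' : Word) : Prop :=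
  ∃ n : ℕ, 0 < n ∧ 0 < Pn β p n w w'

/-- Two states communicate: each is accessible from the other. -/
def Communicate (β p : ℝ) (w w' : Word) : Prop :=
  Accessible β p w w' ∧ Accessible β p w' w

instance : MeasurableSpace Word := ⊤

/-- `ξ` is (a realization of) the discrete-time exclusion-voter Markov chain with
parameters `(β, p)` under the probability measure `μ`. -/
def IsEVChain (β p : ℝ) {Ω : Type*} [MeasurableSpace Ω] (μ : Measure Ω)
    (ξ : ℕ → Ω → Word) : Prop :=
  (∀ t, Measurable (ξ t)) ∧
  ∀ (t : ℕ) (path : ℕ → Word),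
    μ {ω | ∀ i ≤ t + 1, ξ i ω = path i}
      = μ {ω | ∀ i ≤ t, ξ i ω = path i} * ENNReal.ofReal (P β p (path t) (path (t + 1)))

/-- The relaxation time `τ = min {t ∈ ℕ, t ≥ 1 : ξ_t = 𝒟₀}` (`∞` if there is no such `t`). -/
noncomputable def relaxTime {Ω : Type*} (ξ : ℕ → Ω → Word) (ω : Ω) : ℝ≥0∞ :=
  sInf {r : ℝ≥0∞ | ∃ t : ℕ, 0 < t ∧ ξ t ω = groundState ∧ r = (t : ℝ≥0∞)}

/-- The size `|S|` of the hybrid zone. -/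
def hz (w : Word) : ℕ := w.length

/-- The number of blocks `N(S)`: the number of (finite) `1`-blocks of the hybrid zone. -/
def nb (w : Word) : ℕ :=
  ((Finset.range w.length).filter
    (fun b => w.getD b false = true ∧ (b = 0 ∨ w.getD (b - 1) true = false))).card

/-- Number of `0`s among the first `c` positions of the hybrid zone. -/
def z0 (w : Word) (c : ℕ) : ℕ :=
  ((Finset.range c).filter (fun a => w.getD a true = false)).card

/-- Number of `1`s of the hybrid zone at positions `≥ c`. -/
def o1 (w : Word) (c : ℕ) : ℕ :=
  ((Finset.Ico c w.length).filter (fun b => w.getD b false = true)).card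

/-- `f₁(S) = Σᵢ mᵢ Rᵢ = Σᵢ nᵢ Tᵢ`: each `1` contributes the number of `0`s to its left. -/
def f1 (w : Word) : ℕ :=
  ∑ b ∈ (Finset.range w.length).filter (fun b => w.getD b false = true), z0 w b

/-- `f₂(S) = (1/2)(Σᵢ mᵢ Rᵢ² + Σᵢ nᵢ Tᵢ²)`: each `1` contributes the squared number of
`0`s to its left, each `0` the squared number of `1`s to its right. -/
noncomputable def f2 (w : Word) : ℝ :=
  (1 / 2) *
    ((∑ b ∈ (Finset.range w.length).filter (fun b => w.getD b false = true),
        ((z0 w b : ℝ)) ^ 2)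
     + (∑ a ∈ (Finset.range w.length).filter (fun a => w.getD a true = false),
        ((o1 w (a + 1) : ℝ)) ^ 2))

/-- `g(S) = max_{1 ≤ k ≤ N} R_k T_k`: the maximum over the `01`-corners of
(number of `0`s up to the corner) × (number of `1`s after the corner). -/
def gfun (w : Word) : ℕ :=
  ((Finset.range w.length).filter
    (fun a => w.getD a true = false ∧ w.getD (a + 1) false = true)).sup
    (fun a => z0 w (a + 1) * o1 w (a + 1))

/-- `φ₁(S) = Σᵢ Σ_{j=R_{i-1}+1}^{R_i} Σ_{k=1}^{T_i} 1/(j+k)`: the `j`-th `0` (at position `a`,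
so `j = z0 w (a+1)`) contributes `Σ_{k=1}^{T} 1/(j+k)` with `T` the number of `1`s to its right. -/
noncomputable def phi1 (w : Word) : ℝ :=
  ∑ a ∈ (Finset.range w.length).filter (fun a => w.getD a true = false),
    ∑ k ∈ Finset.Icc 1 (o1 w (a + 1)), (1 : ℝ) / ((z0 w (a + 1) : ℝ) + (k : ℝ))


/-- The sum over the `1`s of a word of the squared number of `0`s to their left,
when `z` further `0`s precede the word. -/
def onesWeight : ℕ → Word → ℕ
  | _, [] => 0
  | z, false :: l => onesWeight (z + 1) l
  | z, true :: l => z ^ 2 + onesWeight z l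

/-- The sum over the `0`s of a word of the squared number of `1`s to their right,
when `t` further `1`s follow the word. -/
def zerosWeight : ℕ → Word → ℕ
  | _, [] => 0
  | t, false :: l => (t + l.count true) ^ 2 + zerosWeight t l
  | t, true :: l => zerosWeight t l

lemma z0_cons_succ (x : Bool) (l : Word) (c : ℕ) :
    z0 (x :: l) (c + 1) = (if x = false then 1 else 0) + z0 l c := by
  simp only [z0, Finset.card_filter, Finset.sum_range_succ', List.getD_cons_succ,
    List.getD_cons_zero]
  ring

lemma o1_eq_sum (l : Word) (c : ℕ) :
    o1 l c = ∑ b ∈ Finset.range l.length, if c ≤ b ∧ l.getD b false = true then 1 else 0 := by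
  rw [o1, ← Finset.card_filter]
  congr 1
  ext b
  simp only [Finset.mem_filter, Finset.mem_Ico, Finset.mem_range]
  tauto

lemma o1_cons_succ (x : Bool) (l : Word) (c : ℕ) : o1 (x :: l) (c + 1) = o1 l c := by
  simp only [o1_eq_sum, List.length_cons, Finset.sum_range_succ', List.getD_cons_succ]
  simp

lemma o1_zero (l : Word) : o1 l 0 = l.count true := by
  induction l with
  | nil => simp [o1]
  | cons x l ih =>
    rw [o1_eq_sum] at ih ⊢
    simp only [List.length_cons, Finset.sum_range_succ', List.getD_cons_succ,
      List.getD_cons_zero, zero_le, true_and, List.count_cons] at ih ⊢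
    rw [ih]
    cases x <;> simp

lemma sum_ones_eq_onesWeight (l : Word) (z : ℕ) :
    (∑ b ∈ Finset.range l.length, if l.getD b false = true then (z + z0 l b) ^ 2 else 0)
      = onesWeight z l := by
  induction l generalizing z with
  | nil => simp [onesWeight]
  | cons x l ih =>
    simp only [List.length_cons, Finset.sum_range_succ', List.getD_cons_succ,
      List.getD_cons_zero, z0_cons_succ]
    cases x
    · simpa [onesWeight, add_assoc] using ih (z + 1)
    · have hz : z0 (true :: l) 0 = 0 := by simp [z0]
      simp [onesWeight, hz, ← ih z, add_comm]

lemma sum_zeros_eq_zerosWeight (l : Word) :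
    (∑ a ∈ Finset.range l.length, if l.getD a true = false then (o1 l (a + 1)) ^ 2 else 0)
      = zerosWeight 0 l := by
  induction l with
  | nil => simp [zerosWeight]
  | cons x l ih =>
    simp only [List.length_cons, Finset.sum_range_succ', List.getD_cons_succ,
      List.getD_cons_zero, o1_cons_succ, o1_zero, ih]
    cases x <;> simp [zerosWeight, add_comm]

lemma f2_eq (l : Word) :
    f2 l = 1 / 2 * ((onesWeight 0 l : ℝ) + (zerosWeight 0 l : ℝ)) := by
  rw [f2, ← sum_ones_eq_onesWeight, ← sum_zeros_eq_zerosWeight]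
  simp [Finset.sum_filter]

lemma onesWeight_append (z : ℕ) (a b : Word) :
    onesWeight z (a ++ b) = onesWeight z a + onesWeight (z + a.count false) b := by
  induction a generalizing z with
  | nil => simp [onesWeight]
  | cons x a ih =>
    cases x
    · simp [onesWeight, ih, add_assoc, add_comm 1]
    · simp [onesWeight, ih, add_assoc]

lemma zerosWeight_append (t : ℕ) (a b : Word) :
    zerosWeight t (a ++ b) = zerosWeight (t + b.count true) a + zerosWeight t b := by
  induction a with
  | nil => simp [zerosWeight]
  | cons x a ih =>
    cases x
    · simp only [List.cons_append, zerosWeight, ih, List.count_append]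
      ring
    · simp [zerosWeight, ih]

lemma f2_true_cons (l : Word) : f2 (true :: l) = f2 l := by
  simp [f2_eq, onesWeight, zerosWeight]

lemma f2_append_false (l : Word) : f2 (l ++ [false]) = f2 l := by
  simp [f2_eq, onesWeight_append, zerosWeight_append, onesWeight, zerosWeight]

lemma f2_pad (l : Word) : f2 (pad l) = f2 l := by
  rw [pad, f2_true_cons, f2_append_false]

lemma f2_strip (l : Word) : f2 (strip l) = f2 l := by
  have h1 : ∀ l : Word, f2 (l.dropWhile (· = true)) = f2 l := by
    intro l
    induction l with
    | nil => rfl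
    | cons x l ih => cases x <;> simp_all [f2_true_cons]
  have h2 : ∀ l : Word, f2 (l.dropWhile (· = false)).reverse = f2 l.reverse := by
    intro l
    induction l with
    | nil => rfl
    | cons x l ih => cases x <;> simp_all [f2_append_false]
  rw [strip, h2, List.reverse_reverse, h1]

lemma f2_nonneg (l : Word) : 0 ≤ f2 l := by
  rw [f2_eq]
  positivity

lemma f2_exchange (a b : Word) :
    f2 (a ++ false :: true :: b) =
      f2 (a ++ true :: false :: b) + (a.count false + b.count true + 1) := by
  simp only [f2_eq, onesWeight_append, zerosWeight_append, onesWeight, zerosWeight,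
    List.count_cons]
  push_cast
  simp
  ring

lemma onesWeight_le (z : ℕ) (l : Word) :
    onesWeight z l ≤ l.count true * (z + l.count false) ^ 2 := by
  induction l generalizing z with
  | nil => simp [onesWeight]
  | cons x l ih =>
    cases x
    · simpa [onesWeight, add_assoc, add_comm 1] using ih (z + 1)
    · have h1 := ih z
      have h2 : z ^ 2 ≤ (z + l.count false) ^ 2 := by gcongr; omega
      simp [onesWeight]
      linarith

lemma zerosWeight_le (l : Word) :
    zerosWeight 0 l ≤ l.count false * (l.count true) ^ 2 := by
  induction l with
  | nil => simp [zerosWeight]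
  | cons x l ih =>
    cases x
    · simp [zerosWeight]
      linarith
    · have h2 : (l.count true) ^ 2 ≤ (l.count true + 1) ^ 2 := by gcongr; omega
      have := Nat.mul_le_mul_left (l.count false) h2
      simp [zerosWeight]
      linarith

lemma count_false_add_count_true (l : Word) : l.count false + l.count true = l.length := by
  induction l with
  | nil => rfl
  | cons x l ih => cases x <;> simp <;> omega

lemma f2_le_length_cube (l : Word) : f2 l ≤ (l.length : ℝ) ^ 3 := by
  have h1 : (onesWeight 0 l : ℝ) ≤ l.count true * (0 + l.count false) ^ 2 :=
    mod_cast onesWeight_le 0 l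
  have h2 : (zerosWeight 0 l : ℝ) ≤ l.count false * l.count true ^ 2 :=
    mod_cast zerosWeight_le l
  have h3 : (l.length : ℝ) = l.count false + l.count true :=
    mod_cast (count_false_add_count_true l).symm
  rw [f2_eq, h3]
  have h4 : (0 : ℝ) ≤ l.count false := Nat.cast_nonneg _
  have h5 : (0 : ℝ) ≤ l.count true := Nat.cast_nonneg _
  nlinarith [mul_nonneg h4 h5, mul_nonneg (mul_nonneg h4 h5) h4, mul_nonneg (mul_nonneg h4 h5) h5,
    pow_nonneg h4 3, pow_nonneg h5 3]

lemma length_sq_le_f2 {l : Word} (hl : IsConfig l) : (l.length : ℝ) ^ 2 ≤ 4 * f2 l := by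
  rcases hl with rfl | ⟨h0, h1⟩
  · simp [f2_nonneg]
  have hz : l.count true ^ 2 ≤ zerosWeight 0 l := by
    obtain ⟨t, rfl⟩ := List.head?_eq_some_iff.1 h0
    simp [zerosWeight]
  have ho : l.count false ^ 2 ≤ onesWeight 0 l := by
    obtain ⟨t, rfl⟩ := List.getLast?_eq_some_iff.1 h1
    simp [onesWeight_append, onesWeight]
  have hz' : (l.count true : ℝ) ^ 2 ≤ zerosWeight 0 l := mod_cast hz
  have ho' : (l.count false : ℝ) ^ 2 ≤ onesWeight 0 l := mod_cast ho
  have h3 : (l.length : ℝ) = l.count false + l.count true :=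
    mod_cast (count_false_add_count_true l).symm
  rw [f2_eq, h3]
  nlinarith [sq_nonneg ((l.count false : ℝ) - l.count true)]

/-- The number of `0`s among the first `k` letters of `l`. -/
def zerosBefore (l : Word) (k : ℕ) : ℕ := (l.take k).count false

/-- The number of `1`s of `l` at positions `≥ k`. -/
def onesFrom (l : Word) (k : ℕ) : ℕ := (l.drop k).count true

lemma exists_split {l : Word} {i : ℕ} (hi : i + 1 < l.length) :
    ∃ a b : Word, a.length = i ∧ l = a ++ l.getD i true :: l.getD (i + 1) true :: b := by
  refine ⟨l.take i, l.drop (i + 2), by simp; omega, ?_⟩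
  rw [List.getD_eq_getElem _ _ (by omega), List.getD_eq_getElem _ _ hi,
    List.getElem_cons_drop, List.getElem_cons_drop, List.take_append_drop]

lemma zerosBefore_succ {l : Word} {k : ℕ} :
    (zerosBefore l (k + 1) : ℝ) = zerosBefore l k + if l.getD k true = false then 1 else 0 := by
  rw [zerosBefore, zerosBefore, List.take_add_one, List.count_append]
  rcases h : l[k]? with _ | x
  · simp [h]
  · cases x <;> simp [h]

lemma onesFrom_eq {l : Word} {k : ℕ} (hk : k < l.length) :
    (onesFrom l k : ℝ) = onesFrom l (k + 1) + if l.getD k true = true then 1 else 0 := by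
  rw [onesFrom, onesFrom, List.drop_eq_getElem_cons hk, List.count_cons,
    List.getD_eq_getElem _ _ hk]
  cases l[k] <;> simp

lemma f2_swapPair_of_fall {l : Word} {i : ℕ} (hi : i + 1 < l.length)
    (h0 : l.getD i true = true) (h1 : l.getD (i + 1) true = false) :
    f2 (swapPair l i) = f2 l + (zerosBefore l (i + 1) + onesFrom l (i + 1) + 1) := by
  obtain ⟨a, b, rfl, hl⟩ := exists_split hi
  rw [swapPair, h0, h1]
  rw [h0, h1] at hl
  rw [hl]
  have hs : setPair (a ++ true :: false :: b) a.length false true = a ++ false :: true :: b := by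
    simp [setPair]
  rw [hs, f2_exchange]
  simp [zerosBefore, onesFrom, List.take_append, List.drop_append,
    List.take_of_length_le (Nat.le_succ a.length), List.drop_eq_nil_of_le (Nat.le_succ a.length)]

lemma f2_swapPair_of_rise {l : Word} {i : ℕ} (hi : i + 1 < l.length)
    (h0 : l.getD i true = false) (h1 : l.getD (i + 1) true = true) :
    f2 (swapPair l i) = f2 l + (1 - (zerosBefore l (i + 1) + onesFrom l (i + 1))) := by
  obtain ⟨a, b, rfl, hl⟩ := exists_split hi
  rw [swapPair, h0, h1]
  rw [h0, h1] at hl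
  rw [hl]
  have hs : setPair (a ++ false :: true :: b) a.length true false = a ++ true :: false :: b := by
    simp [setPair]
  rw [hs, f2_exchange]
  simp [zerosBefore, onesFrom, List.take_append, List.drop_append,
    List.take_of_length_le (Nat.le_succ a.length), List.drop_eq_nil_of_le (Nat.le_succ a.length)]
  ring

/-- The sum of `h` over the `10`-pairs of `v` among the first `k` adjacent pairs. -/
def fallSum (v : ℕ → Bool) (h : ℕ → ℝ) (k : ℕ) : ℝ :=
  ∑ i ∈ Finset.range k, if v i = true ∧ v (i + 1) = false then h i else 0

/-- The sum of `h` over the `01`-pairs of `v` among the first `k` adjacent pairs. -/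
def riseSum (v : ℕ → Bool) (h : ℕ → ℝ) (k : ℕ) : ℝ :=
  ∑ i ∈ Finset.range k, if v i = false ∧ v (i + 1) = true then h i else 0

section PairSums

variable {v : ℕ → Bool} {h g : ℕ → ℝ} {Z O : ℕ → ℝ} {k n : ℕ}

lemma fallSum_succ : fallSum v h (k + 1) =
    fallSum v h k + if v k = true ∧ v (k + 1) = false then h k else 0 :=
  Finset.sum_range_succ _ _

lemma riseSum_succ : riseSum v h (k + 1) =
    riseSum v h k + if v k = false ∧ v (k + 1) = true then h k else 0 :=
  Finset.sum_range_succ _ _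

lemma fallSum_add : fallSum v (fun i => h i + g i) k = fallSum v h k + fallSum v g k := by
  rw [fallSum, fallSum, fallSum, ← Finset.sum_add_distrib]
  exact Finset.sum_congr rfl fun i _ => by split_ifs <;> simp

lemma riseSum_add : riseSum v (fun i => h i + g i) k = riseSum v h k + riseSum v g k := by
  rw [riseSum, riseSum, riseSum, ← Finset.sum_add_distrib]
  exact Finset.sum_congr rfl fun i _ => by split_ifs <;> simp

lemma fallSum_const_mul (c : ℝ) : fallSum v (fun i => c * h i) k = c * fallSum v h k := by
  rw [fallSum, fallSum, Finset.mul_sum]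
  exact Finset.sum_congr rfl fun i _ => by split_ifs <;> simp

lemma riseSum_const_mul (c : ℝ) : riseSum v (fun i => c * h i) k = c * riseSum v h k := by
  rw [riseSum, riseSum, Finset.mul_sum]
  exact Finset.sum_congr rfl fun i _ => by split_ifs <;> simp

lemma fallSum_mono
    (hg : ∀ i < k, v i = true → v (i + 1) = false → h i ≤ g i) :
    fallSum v h k ≤ fallSum v g k := by
  refine Finset.sum_le_sum fun i hi => ?_
  split_ifs with hv
  · exact hg i (Finset.mem_range.1 hi) hv.1 hv.2
  · exact le_rfl

lemma riseSum_mono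
    (hg : ∀ i < k, v i = false → v (i + 1) = true → h i ≤ g i) :
    riseSum v h k ≤ riseSum v g k := by
  refine Finset.sum_le_sum fun i hi => ?_
  split_ifs with hv
  · exact hg i (Finset.mem_range.1 hi) hv.1 hv.2
  · exact le_rfl

lemma riseSum_nonneg (hh : ∀ i, 0 ≤ h i) : 0 ≤ riseSum v h k := by
  refine Finset.sum_nonneg fun i _ => ?_
  split_ifs
  exacts [hh i, le_rfl]

lemma fallSum_one_add :
    fallSum v (fun _ => 1) k + (if v k = true then 1 else 0)
      = riseSum v (fun _ => 1) k + (if v 0 = true then 1 else 0) := by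
  induction k with
  | zero => simp [fallSum, riseSum]
  | succ k ih =>
    rw [fallSum_succ, riseSum_succ]
    cases h0 : v k <;> cases h1 : v (k + 1) <;> simp [h0] at ih ⊢ <;> linarith

lemma fallSum_zeros_add (hZ0 : Z 0 = 0)
    (hZ : ∀ k, Z (k + 1) = Z k + if v k = false then 1 else 0) :
    fallSum v (fun i => Z (i + 1)) k + (if v k = true then Z k else 0)
      = riseSum v (fun i => Z (i + 1)) k := by
  induction k with
  | zero => simp [fallSum, riseSum, hZ0]
  | succ k ih =>
    rw [fallSum_succ, riseSum_succ]
    have := hZ k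
    cases h0 : v k <;> cases h1 : v (k + 1) <;> simp [h0] at ih this ⊢ <;> linarith

lemma fallSum_ones (hv0 : v 0 = true)
    (hO : ∀ k < n, O k = O (k + 1) + if v k = true then 1 else 0) (hk : k ≤ n) :
    fallSum v (fun i => O (i + 1)) k
      = riseSum v (fun i => O (i + 1)) k + (if v k = false then O k else 0) := by
  induction k with
  | zero => simp [fallSum, riseSum, hv0]
  | succ k ih =>
    rw [fallSum_succ, riseSum_succ]
    have := hO k hk
    have ih := ih (by omega)
    cases h0 : v k <;> cases h1 : v (k + 1) <;> simp [h0] at ih this ⊢ <;> linarith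

lemma le_riseSum_zeros (hZ0 : Z 0 = 0)
    (hZ : ∀ k, Z (k + 1) = Z k + if v k = false then 1 else 0) (hpos : ∀ k, 0 ≤ Z k) :
    v k = true → Z k ≤ riseSum v (fun i => Z (i + 1)) k := by
  induction k with
  | zero => simp [riseSum, hZ0]
  | succ k ih =>
    intro h1
    rw [riseSum_succ]
    have := hZ k
    cases h0 : v k
    · have := riseSum_nonneg (v := v) (k := k) fun i => hpos (i + 1)
      simp [h1]
      linarith
    · simp [h0] at ih this ⊢
      linarith

lemma le_riseSum_ones (hv1 : v 1 = false)
    (hO : ∀ k < n, O k = O (k + 1) + if v k = true then 1 else 0) (hpos : ∀ k, 0 ≤ O k)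
    (hk : k + 1 ≤ n) :
    (v (k + 1) = false ∧ O (k + 1) = O 1) ∨ O 1 ≤ riseSum v (fun i => O (i + 1)) (k + 1) := by
  induction k with
  | zero => simp [hv1]
  | succ k ih =>
    rw [riseSum_succ]
    have hs := hO (k + 1) hk
    have hp := hpos (k + 1 + 1)
    have hr := riseSum_nonneg (v := v) (k := k + 1) fun i => hpos (i + 1)
    rcases ih (by omega) with ⟨h0, h2⟩ | h2
    · cases h1 : v (k + 1 + 1)
      · left
        simp [h0] at hs ⊢
        linarith
      · right
        simp [h0] at hs ⊢
        linarith
    · right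
      split_ifs <;> linarith

lemma riseSum_one_le (hZ0 : Z 0 = 0)
    (hZ : ∀ k, Z (k + 1) = Z k + if v k = false then 1 else 0) :
    riseSum v (fun _ => 1) k ≤ Z k := by
  induction k with
  | zero => simp [riseSum, hZ0]
  | succ k ih =>
    rw [riseSum_succ, hZ k]
    cases v k
    · simp only [true_and, if_true]
      split_ifs <;> linarith
    · simpa using ih

lemma riseSum_one_sq_le (hZ0 : Z 0 = 0)
    (hZ : ∀ k, Z (k + 1) = Z k + if v k = false then 1 else 0) :
    riseSum v (fun _ => 1) k * (riseSum v (fun _ => 1) k + 1)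
      ≤ 2 * riseSum v (fun i => Z (i + 1)) k := by
  induction k with
  | zero => simp [riseSum]
  | succ k ih =>
    have h1 := riseSum_one_le (v := v) (k := k) hZ0 hZ
    rw [riseSum_succ, riseSum_succ, hZ k]
    cases v k <;> simp [ih]
    split_ifs <;> nlinarith

end PairSums

/-- The letter at position `i` of the padded word. -/
def letter (w : Word) (i : ℕ) : Bool := (pad w).getD i true

/-- The number of `0`s weakly to the left of the `i`-th adjacent pair plus the number of `1`s
weakly to its right, discarding the letters of a `10`-pair itself. -/
noncomputable def pairHeight (w : Word) (i : ℕ) : ℝ :=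
  (zerosBefore (pad w) (i + 1) : ℝ) + onesFrom (pad w) (i + 1)

lemma length_pad (w : Word) : (pad w).length = w.length + 2 := by simp [pad]

lemma pairHeight_nonneg (w : Word) (i : ℕ) : 0 ≤ pairHeight w i := by
  unfold pairHeight
  positivity

lemma pairHeight_le (w : Word) (i : ℕ) : pairHeight w i ≤ w.length + 2 := by
  have h1 : zerosBefore (pad w) (i + 1) + onesFrom (pad w) (i + 1) ≤ (pad w).length := by
    conv_rhs => rw [← List.take_append_drop (i + 1) (pad w), List.length_append]
    exact add_le_add List.count_le_length List.count_le_length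
  rw [length_pad] at h1
  unfold pairHeight
  exact_mod_cast h1

lemma f2_strip_swapPair_of_fall {w : Word} {i : ℕ} (hi : i < w.length + 1)
    (h0 : letter w i = true) (h1 : letter w (i + 1) = false) :
    f2 (strip (swapPair (pad w) i)) = f2 w + (pairHeight w i + 1) := by
  rw [f2_strip, f2_swapPair_of_fall (by rw [length_pad]; omega) h0 h1, f2_pad, pairHeight]

lemma f2_strip_swapPair_of_rise {w : Word} {i : ℕ} (hi : i < w.length + 1)
    (h0 : letter w i = false) (h1 : letter w (i + 1) = true) :
    f2 (strip (swapPair (pad w) i)) = f2 w + (1 - pairHeight w i) := by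
  rw [f2_strip, f2_swapPair_of_rise (by rw [length_pad]; omega) h0 h1, f2_pad, pairHeight]

lemma sum_unlike (w : Word) (f : ℕ → ℝ) :
    ((unlike w).map f).sum =
      fallSum (letter w) f (w.length + 1) + riseSum (letter w) f (w.length + 1) := by
  have hn : (unlike w).Nodup := List.nodup_range.filter _
  rw [← List.sum_toFinset f hn, unlike, List.toFinset_filter, List.toFinset_range,
    Finset.sum_filter, fallSum, riseSum, ← Finset.sum_add_distrib]
  refine Finset.sum_congr rfl fun i _ => ?_
  simp only [letter]
  rcases Bool.eq_false_or_eq_true ((pad w).getD i true) with h0 | h0 <;>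
    rcases Bool.eq_false_or_eq_true ((pad w).getD (i + 1) true) with h1 | h1 <;>
    simp only [h0, h1] <;> simp

lemma hasSum_list_sum {ι α : Type*} (l : List ι) {f : ι → α → ℝ} {a : ι → ℝ}
    (hf : ∀ i ∈ l, HasSum (f i) (a i)) :
    HasSum (fun x => (l.map fun i => f i x).sum) (l.map a).sum := by
  induction l with
  | nil => simp
  | cons i l ih =>
    simp only [List.map_cons, List.sum_cons]
    exact (hf i (by simp)).add (ih fun j hj => hf j (by simp [hj]))

lemma tsum_exclusion (p : ℝ) (w : Word) (G : Word → ℝ) :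
    ∑' w' : Word, P 0 p w w' * G w' =
      (fallSum (letter w) (fun _ => 1) (w.length + 1)
          + riseSum (letter w) (fun _ => 1) (w.length + 1))⁻¹ *
        (fallSum (letter w) (fun i => (1 - p) * G (strip (swapPair (pad w) i)) + p * G w)
            (w.length + 1)
          + riseSum (letter w) (fun i => p * G (strip (swapPair (pad w) i)) + (1 - p) * G w)
            (w.length + 1)) := by
  have hL : ((unlike w).length : ℝ) = fallSum (letter w) (fun _ => 1) (w.length + 1)
      + riseSum (letter w) (fun _ => 1) (w.length + 1) := by
    rw [← sum_unlike]
    simp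
  rw [← hL]
  have key := hasSum_list_sum (unlike w)
    (f := fun i w' => ((unlike w).length : ℝ)⁻¹ *
      ((if letter w i then 1 - p else p) * (if w' = strip (swapPair (pad w) i)
          then G (strip (swapPair (pad w) i)) else 0)
        + (1 - (if letter w i then 1 - p else p)) * (if w' = w then G w else 0)))
    (a := fun i => ((unlike w).length : ℝ)⁻¹ *
      ((if letter w i then 1 - p else p) * G (strip (swapPair (pad w) i))
        + (1 - (if letter w i then 1 - p else p)) * G w))
    (fun i _ => (((hasSum_ite_eq _ _).mul_left _).add ((hasSum_ite_eq _ _).mul_left _)).mul_left _)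
  have hP : (fun w' => P 0 p w w' * G w') = fun w' => ((unlike w).map fun i =>
      ((unlike w).length : ℝ)⁻¹ *
      ((if letter w i then 1 - p else p) * (if w' = strip (swapPair (pad w) i)
          then G (strip (swapPair (pad w) i)) else 0)
        + (1 - (if letter w i then 1 - p else p)) * (if w' = w then G w else 0))).sum := by
    funext w'
    rw [P, ← List.sum_map_mul_right]
    congr 1
    refine List.map_congr_left fun i _ => ?_
    simp only [letter, eq_comm (a := w')]
    generalize strip (swapPair (pad w) i) = s
    generalize ((unlike w).length : ℝ) = L
    by_cases h0 : (pad w).getD i true = true <;> simp only [h0] <;>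
      by_cases h1 : s = w' <;> by_cases h2 : w = w' <;> simp [h1, h2] <;> ring_nf <;> simp
  rw [hP, key.tsum_eq, List.sum_map_mul_left, sum_unlike]
  congr 2
  · refine Finset.sum_congr rfl fun i _ => ?_
    split_ifs with hv
    · simp [hv.1]
    · rfl
  · refine Finset.sum_congr rfl fun i _ => ?_
    split_ifs with hv
    · simp [hv.1]
    · rfl

lemma rpow_add_le {M x d : ℝ} (hM : 0 < M) (hx : 0 < x) (hd : 0 ≤ x + d)
    (hs : M * |d| ≤ x) :
    (x + d) ^ M ≤ x ^ M * (1 + M / x * d + M ^ 2 / x ^ 2 * d ^ 2) := by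
  have hu : |M * (d / x)| ≤ 1 := by
    rw [abs_mul, abs_div, abs_of_pos hM, abs_of_pos hx, ← mul_div_assoc, div_le_one hx]
    exact hs
  have he := (abs_le.1 (Real.abs_exp_sub_one_sub_id_le hu)).2
  have h1 : x + d = x * (1 + d / x) := by field_simp
  have h0 : 0 ≤ 1 + d / x := by
    rw [h1] at hd
    exact nonneg_of_mul_nonneg_right hd hx
  rw [h1, Real.mul_rpow hx.le h0]
  refine mul_le_mul_of_nonneg_left ?_ (Real.rpow_nonneg hx.le _)
  calc (1 + d / x) ^ M ≤ Real.exp (d / x) ^ M :=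
        Real.rpow_le_rpow h0 (by linarith [Real.add_one_le_exp (d / x)]) hM.le
    _ = Real.exp (M * (d / x)) := by rw [← Real.exp_mul, mul_comm]
    _ ≤ 1 + M * (d / x) + (M * (d / x)) ^ 2 := by linarith
    _ = _ := by ring

/-- The `10`-pairs and `01`-pairs of a configuration `S ≠ 𝒟₀`: they balance, and the total height
dominates both the length and the square of the number of blocks. -/
lemma pair_sums {S : Word} (hS : IsConfig S) (hne : S ≠ []) :
    fallSum (letter S) (fun _ => 1) (S.length + 1)
        = riseSum (letter S) (fun _ => 1) (S.length + 1) + 1 ∧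
      fallSum (letter S) (pairHeight S) (S.length + 1)
        = riseSum (letter S) (pairHeight S) (S.length + 1) ∧
      (S.length : ℝ) ≤ riseSum (letter S) (pairHeight S) (S.length + 1) ∧
      riseSum (letter S) (fun _ => 1) (S.length + 1)
          * (riseSum (letter S) (fun _ => 1) (S.length + 1) + 1)
        ≤ 2 * riseSum (letter S) (pairHeight S) (S.length + 1) := by
  obtain ⟨hd, hl⟩ := hS.resolve_left hne
  set n := S.length with hn
  have hpos : 0 < n := List.length_pos_iff.2 hne
  let Z : ℕ → ℝ := fun k => zerosBefore (pad S) k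
  let O : ℕ → ℝ := fun k => onesFrom (pad S) k
  have hZ0 : Z 0 = 0 := by simp [Z, zerosBefore]
  have hZ : ∀ k, Z (k + 1) = Z k + if letter S k = false then 1 else 0 :=
    fun k => zerosBefore_succ
  have hO : ∀ k < n + 2, O k = O (k + 1) + if letter S k = true then 1 else 0 :=
    fun k hk => onesFrom_eq (by rwa [length_pad])
  have hZpos : ∀ k, 0 ≤ Z k := fun k => Nat.cast_nonneg _
  have hOpos : ∀ k, 0 ≤ O k := fun k => Nat.cast_nonneg _
  have hv0 : letter S 0 = true := rfl
  have hv1 : letter S 1 = false := by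
    obtain ⟨t, rfl⟩ := List.head?_eq_some_iff.1 hd
    rfl
  have hvn : letter S n = true := by
    obtain ⟨t, rfl⟩ := List.getLast?_eq_some_iff.1 hl
    simp [letter, pad, hn]
  have hvn1 : letter S (n + 1) = false := by
    simp [letter, pad, hn]
  have hZn : Z n = S.count false := by
    obtain ⟨t, rfl⟩ := List.getLast?_eq_some_iff.1 hl
    simp [Z, zerosBefore, pad, hn]
  have hO1 : O 1 = S.count true := by
    simp [O, onesFrom, pad]
  have hOend : O (n + 1) = 0 := by
    simp [O, onesFrom, pad, hn]
  have hsplit : riseSum (letter S) (pairHeight S) (n + 1)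
      = riseSum (letter S) (fun i => Z (i + 1)) (n + 1)
        + riseSum (letter S) (fun i => O (i + 1)) (n + 1) := riseSum_add
  have hsplit' : fallSum (letter S) (pairHeight S) (n + 1)
      = fallSum (letter S) (fun i => Z (i + 1)) (n + 1)
        + fallSum (letter S) (fun i => O (i + 1)) (n + 1) := fallSum_add
  have hbal := fallSum_one_add (v := letter S) (k := n + 1)
  have hbalZ := fallSum_zeros_add (k := n + 1) hZ0 hZ
  have hbalO := fallSum_ones (k := n + 1) hv0 hO (by omega)
  simp only [hvn1, hv0, hOend, Bool.false_eq_true, if_false, if_true, add_zero] at hbal hbalZ hbalO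
  have hgeZ := le_riseSum_zeros (k := n) hZ0 hZ hZpos hvn
  have hgeO : O 1 ≤ riseSum (letter S) (fun i => O (i + 1)) n := by
    obtain ⟨m, hm⟩ := Nat.exists_eq_add_of_lt hpos
    have hm' : m + 1 = n := by omega
    have := le_riseSum_ones (k := m) hv1 hO hOpos (by omega)
    rw [hm', hvn] at this
    simpa using this
  have hlen : (n : ℝ) = S.count false + S.count true :=
    mod_cast (count_false_add_count_true S).symm
  have hsq := riseSum_one_sq_le (k := n + 1) hZ0 hZ
  have hOnn := riseSum_nonneg (v := letter S) (k := n + 1) fun i => hOpos (i + 1)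
  refine ⟨hbal, by rw [hsplit, hsplit', hbalZ, hbalO], ?_, by rw [hsplit]; linarith⟩
  rw [hsplit, riseSum_succ, riseSum_succ, hvn]
  simp only [Bool.true_eq_false, false_and, if_false]
  linarith

lemma drift_estimate {p M x l N A : ℝ} (hp : 1 / 2 < p) (hM : 0 < M)
    (hl : 1 ≤ l) (hlx : l ^ 2 ≤ 4 * x) (hxl : x ≤ l ^ 3) (hlA : l ≤ A) (hN : 0 ≤ N)
    (hNA : N * (N + 1) ≤ 2 * A) (hx1 : (352 * M / (2 * p - 1)) ^ 2 ≤ x)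
    (hx2 : (20 / (2 * p - 1)) ^ 6 ≤ x) :
    (2 * N + 1)⁻¹ * (x ^ M * (2 * N + 1 + M / x * ((1 - p) * (A + N + 1) + p * (N - A))
        + M ^ 2 / x ^ 2 * (l + 3) * (2 * A + (2 * N + 1)))) - x ^ M
      ≤ -(M * (2 * p - 1) / 10) * x ^ (M - 5 / 6) := by
  set δ := 2 * p - 1 with hδ
  have hδ0 : 0 < δ := by linarith
  have hx : 0 < x := by nlinarith
  have hA : 1 ≤ A := hl.trans hlA
  set L := 2 * N + 1 with hL
  have hL1 : 1 ≤ L := by linarith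
  have hL0 : 0 < L := by linarith
  have hLA : L ^ 2 ≤ 9 * A := by rw [hL]; nlinarith
  set q := A / L with hq
  have hq0 : 0 < q := by positivity
  have hqA : q * L = A := by rw [hq]; field_simp
  have hq2 : A ≤ 9 * q ^ 2 := by
    rw [hq, div_pow, ← mul_div_assoc, le_div_iff₀ (by positivity)]
    nlinarith
  set y := x ^ (1 / 6 : ℝ) with hy
  have hy0 : 0 < y := Real.rpow_pos_of_pos hx _
  have hy6 : y ^ 6 = x := by
    rw [hy, ← Real.rpow_natCast, ← Real.rpow_mul hx.le]
    norm_num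
  have hqy : y / 5 ≤ q := by
    rw [← pow_le_pow_iff_left₀ (by positivity) hq0.le (n := 6) (by norm_num), div_pow, hy6]
    have h1 : x ≤ (9 * q ^ 2) ^ 3 :=
      hxl.trans (pow_le_pow_left₀ (by linarith) (hlA.trans hq2) 3)
    have h2 : 0 < q ^ 6 := by positivity
    have h3 : (9 * q ^ 2) ^ 3 = 729 * q ^ 6 := by ring
    linarith
  have hyδ : 20 ≤ δ * y := by
    have : 20 / δ ≤ y := by
      rw [← pow_le_pow_iff_left₀ (by positivity) hy0.le (n := 6) (by norm_num), hy6]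
      exact hx2
    rwa [div_le_iff₀' hδ0] at this
  have hcoef : M * (l + 3) / x ≤ δ / 44 := by
    set r := √x with hr
    have hr0 : 0 < r := Real.sqrt_pos.2 hx
    have hrx : r ^ 2 = x := Real.sq_sqrt hx.le
    have h1 : 352 * M / δ ≤ r := Real.le_sqrt_of_sq_le hx1
    have h2 : l ≤ 2 * r := by nlinarith
    rw [div_le_iff₀' hδ0] at h1
    rw [div_le_iff₀ hx, ← hrx]
    have h3 : M * (l + 3) ≤ M * (8 * r) := by gcongr; linarith
    nlinarith
  have hbr : (N + 1 - p - δ * A) / L + M * (l + 3) / x * ((2 * A + L) / L) ≤ -(δ * y / 10) := by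
    have h1 : (N + 1 - p - δ * A) / L ≤ 1 - δ * q := by
      rw [div_le_iff₀ hL0, sub_mul 1, mul_assoc, hqA]
      linarith
    have h2 : (2 * A + L) / L ≤ 11 * q := by
      rw [div_le_iff₀ hL0, mul_assoc, hqA]
      nlinarith
    have h3 : M * (l + 3) / x * ((2 * A + L) / L) ≤ δ / 44 * (11 * q) := by
      gcongr
    nlinarith [mul_le_mul_of_nonneg_left hqy hδ0.le]
  have hpow : x ^ (M - 5 / 6) = x ^ M * y / x := by
    rw [hy, ← Real.rpow_add hx, ← Real.rpow_sub_one hx.ne']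
    congr 1
    ring
  have hxM : 0 < x ^ M := Real.rpow_pos_of_pos hx _
  rw [hpow]
  calc _ = x ^ M * (M / x) *
        ((N + 1 - p - δ * A) / L + M * (l + 3) / x * ((2 * A + L) / L)) := by
        have : (1 - p) * (A + N + 1) + p * (N - A) = N + 1 - p - δ * A := by rw [hδ]; ring
        rw [this]
        field_simp
        ring
    _ ≤ x ^ M * (M / x) * (-(δ * y / 10)) := by gcongr
    _ = _ := by ring

lemma drift_le {p M : ℝ} (hp : 1 / 2 < p) (hp1 : p ≤ 1) (hM : 0 < M) {S : Word}
    (hS : IsConfig S) (hne : S ≠ []) (hx1 : (352 * M / (2 * p - 1)) ^ 2 ≤ f2 S)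
    (hx2 : (20 / (2 * p - 1)) ^ 6 ≤ f2 S) :
    (∑' S' : Word, P 0 p S S' * f2 S' ^ M) - f2 S ^ M ≤
      -(M * (2 * p - 1) / 10) * f2 S ^ (M - 5 / 6) := by
  obtain ⟨hF1, hFh, hlA, hNA⟩ := pair_sums hS hne
  have hlx := length_sq_le_f2 hS
  have hl : (1 : ℝ) ≤ S.length := mod_cast List.length_pos_iff.2 hne
  set x := f2 S with hxdef
  set l : ℝ := (S.length : ℝ) with hldef
  set A := riseSum (letter S) (pairHeight S) (S.length + 1) with hA
  set N := riseSum (letter S) (fun _ => 1) (S.length + 1) with hN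
  have hN0 : 0 ≤ N := riseSum_nonneg fun _ => zero_le_one
  have hx : 0 < x := by nlinarith
  have hδ : 0 < 2 * p - 1 := by linarith
  have hsmall : M * (l + 3) ≤ x := by
    set r := √x with hr
    have hr0 : 0 < r := Real.sqrt_pos.2 hx
    have hrx : r ^ 2 = x := Real.sq_sqrt hx.le
    have h1 : 352 * M / (2 * p - 1) ≤ r := Real.le_sqrt_of_sq_le hx1
    have h2 : l ≤ 2 * r := by nlinarith
    rw [div_le_iff₀ hδ] at h1
    rw [← hrx]
    have h3 : M * (l + 3) ≤ M * (8 * r) := by gcongr; linarith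
    nlinarith
  have hxM : 0 < x ^ M := Real.rpow_pos_of_pos hx _
  have hstep : ∀ i d c, 0 ≤ c → c ≤ 1 → |d| ≤ pairHeight S i + 1 →
      f2 (strip (swapPair (pad S) i)) = x + d →
      c * f2 (strip (swapPair (pad S) i)) ^ M + (1 - c) * x ^ M
        ≤ x ^ M * (1 + c * (M / x) * d + M ^ 2 / x ^ 2 * (l + 3) * (pairHeight S i + 1)) := by
    intro i d c hc0 hc1 hd hf
    have hh := pairHeight_le S i
    have hdl : |d| ≤ l + 3 := by linarith
    have h1 := rpow_add_le hM hx (hf ▸ f2_nonneg _)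
      ((mul_le_mul_of_nonneg_left hdl hM.le).trans hsmall)
    have hd2 : d ^ 2 ≤ (l + 3) * (pairHeight S i + 1) := by
      rw [← sq_abs, sq]
      exact mul_le_mul hdl hd (abs_nonneg _) (by positivity)
    have hd3 : c * (M ^ 2 / x ^ 2 * d ^ 2)
        ≤ 1 * (M ^ 2 / x ^ 2 * ((l + 3) * (pairHeight S i + 1))) := by
      gcongr
    rw [hf]
    calc _ ≤ c * (x ^ M * (1 + M / x * d + M ^ 2 / x ^ 2 * d ^ 2)) + (1 - c) * x ^ M := by
          gcongr
      _ = x ^ M * (1 + c * (M / x) * d + c * (M ^ 2 / x ^ 2 * d ^ 2)) := by ring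
      _ ≤ _ := by
          refine mul_le_mul_of_nonneg_left ?_ hxM.le
          linarith
  have hfall : fallSum (letter S)
      (fun i => (1 - p) * f2 (strip (swapPair (pad S) i)) ^ M + p * x ^ M) (S.length + 1)
      ≤ x ^ M * (N + 1 + (1 - p) * (M / x) * (A + (N + 1))
          + M ^ 2 / x ^ 2 * (l + 3) * (A + (N + 1))) := by
    refine (fallSum_mono (g := fun i => x ^ M * (1 + ((1 - p) * (M / x)
      * (pairHeight S i + 1) + M ^ 2 / x ^ 2 * (l + 3) * (pairHeight S i + 1))))
      fun i hi h0 h1 => ?_).trans_eq ?_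
    · have := hstep i (pairHeight S i + 1) (1 - p) (by linarith) (by linarith)
        (abs_of_nonneg (by linarith [pairHeight_nonneg S i])).le
        (f2_strip_swapPair_of_fall (by omega) h0 h1)
      linarith
    · simp only [fallSum_const_mul, fallSum_add]
      rw [hF1, hFh]
      ring
  have hrise : riseSum (letter S)
      (fun i => p * f2 (strip (swapPair (pad S) i)) ^ M + (1 - p) * x ^ M) (S.length + 1)
      ≤ x ^ M * (N + p * (M / x) * (N - A) + M ^ 2 / x ^ 2 * (l + 3) * (A + N)) := by
    refine (riseSum_mono (g := fun i => x ^ M * (1 + (p * (M / x)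
      * (1 + (-1) * pairHeight S i) + M ^ 2 / x ^ 2 * (l + 3) * (pairHeight S i + 1))))
      fun i hi h0 h1 => ?_).trans_eq ?_
    · have := hstep i (1 - pairHeight S i) p (by linarith) hp1
        (abs_le.2 (by constructor <;> linarith [pairHeight_nonneg S i]))
        (f2_strip_swapPair_of_rise (by omega) h0 h1)
      linarith
    · simp only [riseSum_const_mul, riseSum_add]
      rw [← hA, ← hN]
      ring
  refine le_trans ?_ (drift_estimate hp hM hl hlx (f2_le_length_cube S) hlA hN0 hNA hx1 hx2)
  rw [tsum_exclusion, hF1]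
  have hL : N + 1 + N = 2 * N + 1 := by ring
  rw [hL]
  gcongr
  refine (add_le_add hfall hrise).trans_eq ?_
  ring

/-- Lemma 13 (drift of `f₂^M` for pure exclusion): if `β = 0`, `p > 1/2` and
`M ∈ (0,∞)`, then there is `C ∈ (0,∞)` such that for all but finitely many `S ∈ 𝒟`,
`Σ_{S'} P(S,S') f₂(S')^M − f₂(S)^M ≤ −C f₂(S)^{M−5/6}`. -/
theorem f2_pow_drift_bound
    (p : ℝ) (hp : 1 / 2 < p) (hp1 : p ≤ 1)
    (M : ℝ) (hM : 0 < M) :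
    ∃ C : ℝ, 0 < C ∧ ∃ F : Finset Word,
      ∀ S : Word, IsConfig S → S ∉ F →
        (∑' S' : Word, P 0 p S S' * f2 S' ^ M) - f2 S ^ M ≤
          -C * f2 S ^ (M - 5 / 6) := by
  set K := max ((352 * M / (2 * p - 1)) ^ 2) ((20 / (2 * p - 1)) ^ 6) with hK
  refine ⟨M * (2 * p - 1) / 10, by
    have : 0 < 2 * p - 1 := by linarith
    positivity, (List.finite_length_le Bool ⌈4 * K⌉₊).toFinset, fun S hS hF => ?_⟩
  rw [Set.Finite.mem_toFinset, Set.mem_ofPred_eq, not_le] at hF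
  have h1 : 4 * K < S.length := (Nat.le_ceil _).trans_lt (mod_cast hF)
  have hl : 0 < S.length := by omega
  have hl' : (1 : ℝ) ≤ S.length := mod_cast hl
  have h2 := length_sq_le_f2 hS
  have hKx : K ≤ f2 S := by nlinarith
  exact drift_le hp hp1 hM hS (List.length_pos_iff.1 hl) ((le_max_left _ _).trans hKx)
    ((le_max_right _ _).trans hKx)

end EV
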